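/- Conformal covariance of the fermionic observables (Lemma 3.14, stated in squared form to avoid square-root branches): let $D, D' \subseteq \mathbb{C}$ be domains, let $\varphi : D \to D'$ be a bijective holomorphic map with holomorphic inverse, let $w, z \in D$, let $\psi$ be a normalized Riemann map of $D$ at $w$, and let $\tilde\psi$ be a normalized Riemann map of $D'$ at $\varphi(w)$. Then: (i) $\overline{\varphi'(w)} \, \varphi'(z) \cdot \tilde\psi'(\varphi(w)) \, \tilde\psi'(\varphi(z)) = \psi'(w) \, \psi'(z)$; and (ii) if $z \ne w$, then $\varphi'(w) \, \varphi'(z) \cdot \dfrac{\tilde\psi'(\varphi(w)) \, \tilde\psi'(\varphi(z))}{\tilde\psi(\varphi(z))^2} = \dfrac{\psi'(w) \, \psi'(z)}{\psi(z)^2}$. These are the squares of the covariance relations $f_-^D(w,z) = \overline{\varphi'(w)}^{1/2} \varphi'(z)^{1/2} f_-^{D'}(\varphi(w), \varphi(z))$ and $f_+^D(w,z) = \varphi'(w)^{1/2} \varphi'(z)^{1/2} f_+^{D'}(\varphi(w), \varphi(z))$. -/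

import Mathlib

open Complex

/-- A normalized Riemann map of a domain `D ⊆ ℂ` at `w ∈ D`: a holomorphic bijection
from `D` onto the open unit disc with holomorphic inverse, vanishing at `w`, whose
derivative at `w` is a positive real number. -/
def IsNormalizedRiemannMap (D : Set ℂ) (w : ℂ) (ψ : ℂ → ℂ) : Prop :=
  DifferentiableOn ℂ ψ D ∧
  Set.MapsTo ψ D (Metric.ball (0 : ℂ) 1) ∧
  (∃ g : ℂ → ℂ, DifferentiableOn ℂ g (Metric.ball (0 : ℂ) 1) ∧
    Set.MapsTo g (Metric.ball (0 : ℂ) 1) D ∧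
    Set.LeftInvOn g ψ D ∧ Set.RightInvOn g ψ (Metric.ball (0 : ℂ) 1)) ∧
  ψ w = 0 ∧
  (∃ r : ℝ, 0 < r ∧ deriv ψ w = (r : ℂ))

/-- A holomorphic automorphism of the unit disc fixing the origin is a rotation. -/
theorem exists_rotation_of_disc_automorphism {h k : ℂ → ℂ}
    (hh : DifferentiableOn ℂ h (Metric.ball 0 1))
    (hm : Set.MapsTo h (Metric.ball 0 1) (Metric.ball 0 1))
    (hk : DifferentiableOn ℂ k (Metric.ball 0 1))
    (km : Set.MapsTo k (Metric.ball 0 1) (Metric.ball 0 1))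
    (hkh : Set.LeftInvOn k h (Metric.ball 0 1)) (h0 : h 0 = 0) :
    ∃ c : ℂ, ‖c‖ = 1 ∧ ∀ ζ ∈ Metric.ball (0 : ℂ) 1, h ζ = c * ζ := by
  have k0 : k 0 = 0 := by
    simpa [h0] using hkh (Metric.mem_ball_self one_pos : (0 : ℂ) ∈ Metric.ball 0 1)
  have norm_h : ∀ ζ ∈ Metric.ball (0 : ℂ) 1, ‖h ζ‖ = ‖ζ‖ := by
    intro ζ hζ
    apply le_antisymm
    · exact norm_le_norm_of_mapsTo_ball hh (hm.mono_right Metric.ball_subset_closedBall) h0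
        (by simpa using hζ)
    · have := norm_le_norm_of_mapsTo_ball hk (km.mono_right Metric.ball_subset_closedBall) k0
        (z := h ζ) (by simpa using hm hζ)
      rwa [hkh hζ] at this
  have half_mem : (1 / 2 : ℂ) ∈ Metric.ball (0 : ℂ) 1 := by
    rw [mem_ball_zero_iff]; norm_num
  obtain ⟨c, hc, haff⟩ := affine_of_mapsTo_ball_of_exists_norm_dslope_eq_div' (c := 0) (R₁ := 1)
    (R₂ := 1) hh (by simpa [h0] using hm.mono_right Metric.ball_subset_closedBall)
    ⟨1 / 2, half_mem, by
      rw [dslope_of_ne _ (by norm_num), slope_def_field, h0, sub_zero, sub_zero, norm_div,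
        norm_h _ half_mem]
      norm_num⟩
  refine ⟨c, by simpa using hc, fun ζ hζ => ?_⟩
  simpa [h0, mul_comm] using haff hζ

/-- Two Riemann maps at corresponding points of biholomorphic domains differ by a rotation. -/
theorem IsNormalizedRiemannMap.exists_rotation {D D' : Set ℂ} {φ φinv ψ ψt : ℂ → ℂ} {w : ℂ}
    (hφ : DifferentiableOn ℂ φ D) (hφm : Set.MapsTo φ D D')
    (hφinv : DifferentiableOn ℂ φinv D') (hφinvm : Set.MapsTo φinv D' D)
    (hli : Set.LeftInvOn φinv φ D) (hw : w ∈ D)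
    (hψ : IsNormalizedRiemannMap D w ψ) (hψt : IsNormalizedRiemannMap D' (φ w) ψt) :
    ∃ c : ℂ, ‖c‖ = 1 ∧ ∀ x ∈ D, ψt (φ x) = c * ψ x := by
  obtain ⟨hψd, hψm, ⟨g, hgd, hgm, hgl, hgr⟩, hψw, -⟩ := hψ
  obtain ⟨hψtd, hψtm, ⟨gt, hgtd, hgtm, hgtl, -⟩, hψtw, -⟩ := hψt
  have g0 : g 0 = w := by rw [← hψw]; exact hgl hw
  obtain ⟨c, hc, hrot⟩ := exists_rotation_of_disc_automorphism
    (h := ψt ∘ φ ∘ g) (k := ψ ∘ φinv ∘ gt)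
    (hψtd.comp (hφ.comp hgd hgm) (hφm.comp hgm)) (hψtm.comp (hφm.comp hgm))
    (hψd.comp (hφinv.comp hgtd hgtm) (hφinvm.comp hgtm)) (hψm.comp (hφinvm.comp hgtm))
    (fun ζ hζ => by
      simp only [Function.comp_apply]
      rw [hgtl (hφm (hgm hζ)), hli (hgm hζ), hgr hζ])
    (by simp [g0, hψtw])
  refine ⟨c, hc, fun x hx => ?_⟩
  simpa [hgl hx] using hrot (ψ x) (hψm hx)

/-- Conformal covariance of the fermionic observables (Lemma 3.14, squared form):
for a biholomorphism `φ : D → D'`, points `w, z ∈ D`, and normalized Riemann maps `ψ`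
of `D` at `w` and `ψ̃` of `D'` at `φ(w)`, one has
(i) `conj(φ'(w)) φ'(z) ψ̃'(φ(w)) ψ̃'(φ(z)) = ψ'(w) ψ'(z)` and
(ii) if `z ≠ w`, `φ'(w) φ'(z) ψ̃'(φ(w)) ψ̃'(φ(z)) / ψ̃(φ(z))² = ψ'(w) ψ'(z) / ψ(z)²`,
the squares of the covariance relations for `f₋` and `f₊`. -/
theorem stmt10 (D D' : Set ℂ) (hD : IsOpen D) (hDc : IsConnected D)
    (hD' : IsOpen D') (hD'c : IsConnected D')
    (φ φinv : ℂ → ℂ)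
    (hφ : DifferentiableOn ℂ φ D) (hφm : Set.MapsTo φ D D')
    (hφinv : DifferentiableOn ℂ φinv D') (hφinvm : Set.MapsTo φinv D' D)
    (hli : Set.LeftInvOn φinv φ D) (hri : Set.RightInvOn φinv φ D')
    (w z : ℂ) (hw : w ∈ D) (hz : z ∈ D)
    (ψ ψt : ℂ → ℂ)
    (hψ : IsNormalizedRiemannMap D w ψ)
    (hψt : IsNormalizedRiemannMap D' (φ w) ψt) :
    starRingEnd ℂ (deriv φ w) * deriv φ z * (deriv ψt (φ w) * deriv ψt (φ z))
      = deriv ψ w * deriv ψ z ∧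
    (z ≠ w →
      deriv φ w * deriv φ z * (deriv ψt (φ w) * deriv ψt (φ z) / (ψt (φ z)) ^ 2)
        = deriv ψ w * deriv ψ z / (ψ z) ^ 2) := by
  obtain ⟨c, hc, hrot⟩ := hψ.exists_rotation hφ hφm hφinv hφinvm hli hw hψt
  obtain ⟨hψd, -, -, -, r, -, hr⟩ := hψ
  obtain ⟨hψtd, -, -, -, R, -, hR⟩ := hψt
  have hderiv : ∀ x ∈ D, deriv ψt (φ x) * deriv φ x = c * deriv ψ x := by
    intro x hx
    have hxD := hD.mem_nhds hx
    have hcomp := (hψtd.differentiableAt (hD'.mem_nhds (hφm hx))).hasDerivAt.comp x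
      (hφ.differentiableAt hxD).hasDerivAt
    have hmul := (hψd.differentiableAt hxD).hasDerivAt.const_mul c
    refine hcomp.unique (hmul.congr_of_eventuallyEq ?_)
    filter_upwards [hxD] with y hy using hrot y hy
  have hdw := hderiv w hw
  have hdz := hderiv z hz
  have hcc : starRingEnd ℂ c * c = 1 := by
    rw [mul_comm, Complex.mul_conj, Complex.normSq_eq_norm_sq, hc]; norm_num
  have hc0 : c ≠ 0 := by
    rintro rfl
    simp at hc
  constructor
  · rw [hR, hr] at hdw ⊢
    have hconj := congrArg (starRingEnd ℂ) hdw
    simp only [map_mul, Complex.conj_ofReal] at hconj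
    linear_combination (deriv φ z * deriv ψt (φ z)) * hconj + starRingEnd ℂ c * r * hdz
      + r * deriv ψ z * hcc
  · intro _
    rw [hrot z hz]
    calc deriv φ w * deriv φ z * (deriv ψt (φ w) * deriv ψt (φ z) / (c * ψ z) ^ 2)
        = (deriv ψt (φ w) * deriv φ w) * (deriv ψt (φ z) * deriv φ z) / (c * ψ z) ^ 2 := by ring
      _ = c ^ 2 * (deriv ψ w * deriv ψ z) / (c ^ 2 * ψ z ^ 2) := by rw [hdw, hdz]; ring
      _ = deriv ψ w * deriv ψ z / ψ z ^ 2 := mul_div_mul_left _ _ (pow_ne_zero 2 hc0)
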